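/- Fix g ≥ 1 and N := 2g+1. Let U ⊆ ℂ^N be open, and let q₁,…,q_g, w₁,…,w_g, α₁,…,α_g, f₁,…,f_N : U → ℂ be functions that are ℂ-differentiable along every coordinate direction. Assume that at every point u = (u₁,…,u_N) ∈ U: the coordinates u₁,…,u_N are pairwise distinct; q₁(u),…,q_g(u) are pairwise distinct and q_j(u) ≠ u_n for all j,n; w_j²·∏_{m=1}^N (q_j − u_m) = 1 for all j; f_n²·∏_{m≠n}(u_n − u_m) = 4 for all n. Define R(z) := Σ_{j=1}^g (1/(z−q_j) + α_j)·∏_{β≠j}(z−q_β)/(w_j·∏_{β≠j}(q_j−q_β)); Ω_n := f_n·R(u_n); Ω_∞ := −2·Σ_{j=1}^g α_j/(w_j·∏_{β≠j}(q_j−q_β)); A12_n := (1/4)·Ω_n·f_n·∏_{β=1}^g (u_n−q_β); β_n := A12_n·(Σ_{j=1}^g 1/(w_j·(u_n−q_j)·∏_{β≠j}(q_j−q_β)) − Ω_∞/2); and the 2×2 matrices A⁽ⁿ⁾ := [[−1/4 − β_n/2, A12_n], [−(β_n+β_n²)/(4·A12_n), 1/4 + β_n/2]]. Assume further that at every u ∈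 U: A12_n ≠ 0 for all n, and the partial derivative relations hold: ∂q_j/∂u_k = −(1/4)·Ω_k·f_k·∏_{α≠j}(u_k−q_α)/(w_j·∏_{α≠j}(q_j−q_α)) for all j,k; ∂Ω_n/∂u_k = (1/2)·(Ω_k/(u_k−u_n))·(f_k/f_n)·∏_{α=1}^g(u_k−q_α)/∏_{α=1}^g(u_n−q_α) for all k ≠ n; ∂Ω_∞/∂u_k = −(1/4)·Ω_k·f_k·∏_{α=1}^g(u_k−q_α) for all k; ∂f_n/∂u_k = (1/2)·f_n/(u_n−u_k) for all k ≠ n. Then the matrix-valued functions A⁽ⁿ⁾ satisfy the Schlesinger system on U: ∂A⁽ⁿ⁾/∂u_k = [A⁽ᵏ⁾, A⁽ⁿ⁾]/(u_k−u_n) for all k ≠ n, and ∂A⁽ᵏ⁾/∂u_k = −Σ_{n≠k} [A⁽ᵏ⁾, A⁽ⁿ⁾]/(u_k−u_n) for all k. -/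

import Mathlib

open Finset

/-- The residue matrix built from the coefficient `β` and the `(1,2)`-entry `a`. -/
noncomputable def resMat (β a : ℂ) : Matrix (Fin 2) (Fin 2) ℂ :=
  !![-(1 : ℂ) / 4 - β / 2, a; -(β + β ^ 2) / (4 * a), 1 / 4 + β / 2]

/-- The rational function
`R(z) = Σ_j (1/(z−q_j) + α_j)·∏_{β≠j}(z−q_β)/(w_j·∏_{β≠j}(q_j−q_β))`. -/
noncomputable def Rfun {g : ℕ} (q w a : Fin g → ℂ) (z : ℂ) : ℂ :=
  ∑ j, (1 / (z - q j) + a j) * (∏ β ∈ univ.erase j, (z - q β)) /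
    (w j * ∏ β ∈ univ.erase j, (q j - q β))

/-- `Ω_∞ = −2·Σ_j α_j/(w_j·∏_{β≠j}(q_j−q_β))`. -/
noncomputable def OmegaInfty {g : ℕ} (q w a : Fin g → ℂ) : ℂ :=
  -2 * ∑ j, a j / (w j * ∏ β ∈ univ.erase j, (q j - q β))

/-- `Ω_n = f_n · R(u_n)`, as a function of the point `p = (u_1, …, u_N)`. -/
noncomputable def OmegaP {g N : ℕ} (qf wf af : Fin g → (Fin N → ℂ) → ℂ)
    (ff : Fin N → (Fin N → ℂ) → ℂ) (n : Fin N) (p : Fin N → ℂ) : ℂ :=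
  ff n p * Rfun (fun j => qf j p) (fun j => wf j p) (fun j => af j p) (p n)

/-- `A12_n = (1/4)·Ω_n·f_n·∏_{β}(u_n−q_β)`. -/
noncomputable def A12P {g N : ℕ} (qf wf af : Fin g → (Fin N → ℂ) → ℂ)
    (ff : Fin N → (Fin N → ℂ) → ℂ) (n : Fin N) (p : Fin N → ℂ) : ℂ :=
  (1 / 4) * OmegaP qf wf af ff n p * ff n p * ∏ β, (p n - qf β p)

/-- `β_n = A12_n·(Σ_j 1/(w_j·(u_n−q_j)·∏_{β≠j}(q_j−q_β)) − Ω_∞/2)`. -/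
noncomputable def betaP {g N : ℕ} (qf wf af : Fin g → (Fin N → ℂ) → ℂ)
    (ff : Fin N → (Fin N → ℂ) → ℂ) (n : Fin N) (p : Fin N → ℂ) : ℂ :=
  A12P qf wf af ff n p *
    ((∑ j, 1 / (wf j p * (p n - qf j p) * ∏ β ∈ univ.erase j, (qf j p - qf β p))) -
      OmegaInfty (fun j => qf j p) (fun j => wf j p) (fun j => af j p) / 2)

/-- The residue matrix `A⁽ⁿ⁾` as a function of the point `p = (u_1, …, u_N)`. -/
noncomputable def AmatP {g N : ℕ} (qf wf af : Fin g → (Fin N → ℂ) → ℂ)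
    (ff : Fin N → (Fin N → ℂ) → ℂ) (n : Fin N) (p : Fin N → ℂ) :
    Matrix (Fin 2) (Fin 2) ℂ :=
  resMat (betaP qf wf af ff n p) (A12P qf wf af ff n p)

section HermiteResidues

open Polynomial

theorem eval_prod_X_sub_C {ι : Type*} (s : Finset ι) (v : ι → ℂ) (x : ℂ) :
    (∏ i ∈ s, (X - C (v i))).eval x = ∏ i ∈ s, (x - v i) := by
  simp [eval_prod]

theorem natDegree_prod_X_sub_C_eq_card {ι : Type*} (s : Finset ι) (v : ι → ℂ) :
    (∏ i ∈ s, (X - C (v i))).natDegree = #s := by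
  simp [natDegree_prod_of_monic _ _ fun i _ => monic_X_sub_C (v i)]

/-- Logarithmic derivative of a product of linear factors. -/
theorem eval_derivative_prod_X_sub_C {ι : Type*} [DecidableEq ι] (s : Finset ι) (v : ι → ℂ)
    (x : ℂ) (hx : ∀ i ∈ s, x - v i ≠ 0) :
    (derivative (∏ i ∈ s, (X - C (v i)))).eval x =
      (∏ i ∈ s, (x - v i)) * ∑ i ∈ s, 1 / (x - v i) := by
  rw [derivative_prod_finset, eval_finsetSum, Finset.mul_sum]
  refine Finset.sum_congr rfl fun i hi => ?_
  rw [← Finset.mul_prod_erase s _ hi]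
  have := hx i hi
  simp [eval_prod]
  field_simp

/-- The derivative at a root of a product of linear factors. -/
theorem eval_derivative_prod_X_sub_C_of_mem {ι : Type*} [DecidableEq ι] (s : Finset ι)
    (v : ι → ℂ) {j : ι} (hj : j ∈ s) :
    (derivative (∏ i ∈ s, (X - C (v i)))).eval (v j) = ∏ i ∈ s.erase j, (v j - v i) := by
  rw [← Finset.mul_prod_erase s _ hj]
  simp [eval_prod]

theorem sq_X_sub_C_dvd {p : ℂ[X]} {x : ℂ} (h₀ : p.eval x = 0)
    (h₁ : (derivative p).eval x = 0) : (X - C x) ^ 2 ∣ p := by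
  obtain ⟨r, rfl⟩ := dvd_iff_isRoot.mpr h₀
  have hr : r.eval x = 0 := by simpa using h₁
  obtain ⟨t, rfl⟩ := dvd_iff_isRoot.mpr hr
  exact ⟨t, by ring⟩

variable {ι κ : Type*} [Fintype ι] [DecidableEq ι] [Fintype κ] [DecidableEq κ]

/-- The sum of the residues of `H / (∏ (z - q j)² ∏ (z - u n))` is the coefficient of `H` in
degree one less than that of the denominator. -/
theorem sum_residues_eq_coeff (q : ι → ℂ) (u : κ → ℂ) (hq : ∀ i j, i ≠ j → q i ≠ q j)
    (hu : ∀ m n, m ≠ n → u m ≠ u n) (hqu : ∀ j n, q j ≠ u n) (H : ℂ[X])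
    (hH : H.natDegree < 2 * Fintype.card ι + Fintype.card κ) :
    ∑ j, ((derivative H).eval (q j) - H.eval (q j) *
        (2 * ∑ β ∈ univ.erase j, 1 / (q j - q β) + ∑ m, 1 / (q j - u m))) /
        ((∏ β ∈ univ.erase j, (q j - q β)) ^ 2 * ∏ m, (q j - u m)) +
      ∑ n, H.eval (u n) / ((∏ β, (u n - q β)) ^ 2 * ∏ m ∈ univ.erase n, (u n - u m)) =
      H.coeff (2 * Fintype.card ι + Fintype.card κ - 1) := by
  set P : ℂ[X] := ∏ β, (X - C (q β)) with hP
  set F : ℂ[X] := ∏ m, (X - C (u m)) with hF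
  set W : ι → ℂ[X] := fun j => (∏ β ∈ univ.erase j, (X - C (q β))) ^ 2 * F with hW
  set V : κ → ℂ[X] := fun n => P ^ 2 * ∏ m ∈ univ.erase n, (X - C (u m)) with hV
  set y : ι → ℂ := fun j => H.eval (q j) / (W j).eval (q j) with hy
  set s : ι → ℂ := fun j => ((derivative H).eval (q j) - H.eval (q j) *
        (2 * ∑ β ∈ univ.erase j, 1 / (q j - q β) + ∑ m, 1 / (q j - u m))) /
        (W j).eval (q j) with hs
  set r : κ → ℂ := fun n => H.eval (u n) / (V n).eval (u n) with hr
  have hqq : ∀ j, ∀ β ∈ univ.erase j, q j - q β ≠ 0 := fun j β hβ =>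
    sub_ne_zero.mpr (hq j β (Finset.ne_of_mem_erase hβ).symm)
  have huu : ∀ n, ∀ m ∈ univ.erase n, u n - u m ≠ 0 := fun n m hm =>
    sub_ne_zero.mpr (hu n m (Finset.ne_of_mem_erase hm).symm)
  have hWe : ∀ j, (W j).eval (q j) =
      (∏ β ∈ univ.erase j, (q j - q β)) ^ 2 * ∏ m, (q j - u m) := by
    intro j; simp only [hW, hF, eval_mul, eval_pow, eval_prod_X_sub_C]
  have hVe : ∀ n, (V n).eval (u n) =
      (∏ β, (u n - q β)) ^ 2 * ∏ m ∈ univ.erase n, (u n - u m) := by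
    intro n; simp only [hV, hP, eval_mul, eval_pow, eval_prod_X_sub_C]
  have hW0 : ∀ j, (W j).eval (q j) ≠ 0 := fun j => by
    rw [hWe]
    exact mul_ne_zero (pow_ne_zero _ (Finset.prod_ne_zero_iff.mpr (hqq j)))
      (Finset.prod_ne_zero_iff.mpr fun m _ => sub_ne_zero.mpr (hqu j m))
  have hV0 : ∀ n, (V n).eval (u n) ≠ 0 := fun n => by
    rw [hVe]
    exact mul_ne_zero (pow_ne_zero _ (Finset.prod_ne_zero_iff.mpr fun j _ =>
      sub_ne_zero.mpr (hqu j n).symm)) (Finset.prod_ne_zero_iff.mpr (huu n))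
  have hWd : ∀ j, (derivative (W j)).eval (q j) = (W j).eval (q j) *
      (2 * ∑ β ∈ univ.erase j, 1 / (q j - q β) + ∑ m, 1 / (q j - u m)) := by
    intro j
    rw [hWe]
    simp only [hW, hF, derivative_mul, derivative_pow, eval_add, eval_mul, eval_pow,
      eval_prod_X_sub_C, eval_derivative_prod_X_sub_C _ _ _ (hqq j),
      eval_derivative_prod_X_sub_C univ u _ fun m _ => sub_ne_zero.mpr (hqu j m)]
    simp
    ring
  have hWm : ∀ j, (W j).Monic := fun j =>
    ((monic_prod_X_sub_C _ _).pow 2).mul (monic_prod_X_sub_C _ _)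
  have hPm : P.Monic := monic_prod_X_sub_C _ _
  have hVm : ∀ n, (V n).Monic := fun n => (hPm.pow 2).mul (monic_prod_X_sub_C _ _)
  have hWn : ∀ j, (W j).natDegree + 2 = 2 * Fintype.card ι + Fintype.card κ := by
    intro j
    have : 1 ≤ Fintype.card ι := Fintype.card_pos_iff.mpr ⟨j⟩
    simp only [hW, hF]
    rw [((monic_prod_X_sub_C _ _).pow 2).natDegree_mul (monic_prod_X_sub_C _ _),
      (monic_prod_X_sub_C _ _).natDegree_pow, natDegree_prod_X_sub_C_eq_card,
      natDegree_prod_X_sub_C_eq_card, Finset.card_erase_of_mem (mem_univ j), card_univ, card_univ]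
    omega
  have hVn : ∀ n, (V n).natDegree + 1 = 2 * Fintype.card ι + Fintype.card κ := by
    intro n
    have : 1 ≤ Fintype.card κ := Fintype.card_pos_iff.mpr ⟨n⟩
    simp only [hV, hP]
    rw [((monic_prod_X_sub_C _ _).pow 2).natDegree_mul (monic_prod_X_sub_C _ _),
      (monic_prod_X_sub_C _ _).natDegree_pow, natDegree_prod_X_sub_C_eq_card,
      natDegree_prod_X_sub_C_eq_card, Finset.card_erase_of_mem (mem_univ n), card_univ, card_univ]
    omega
  set T : ι → ℂ[X] := fun j => C (y j) * W j + C (s j) * ((X - C (q j)) * W j) with hT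
  set D : ℂ[X] := H - ∑ j, T j - ∑ n, C (r n) * V n with hD
  have hXWn : ∀ j, ((X - C (q j)) * W j).natDegree =
      2 * Fintype.card ι + Fintype.card κ - 1 := fun j => by
    rw [(monic_X_sub_C (q j)).natDegree_mul (hWm j), natDegree_X_sub_C]
    have := hWn j
    omega
  have hDd : D.natDegree < 2 * Fintype.card ι + Fintype.card κ := by
    have h1 : H.natDegree ≤ 2 * Fintype.card ι + Fintype.card κ - 1 := by omega
    have h2 : (∑ j, T j).natDegree ≤ 2 * Fintype.card ι + Fintype.card κ - 1 := by
      refine natDegree_sum_le_of_forall_le _ _ fun j _ => ?_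
      refine natDegree_add_le_of_degree_le ?_ ?_
      · have := hWn j
        exact (natDegree_C_mul_le _ _).trans (by omega)
      · exact (natDegree_C_mul_le _ _).trans (hXWn j).le
    have h3 : (∑ n, C (r n) * V n).natDegree ≤
        2 * Fintype.card ι + Fintype.card κ - 1 := by
      refine natDegree_sum_le_of_forall_le _ _ fun n _ => ?_
      have := hVn n
      exact (natDegree_C_mul_le _ _).trans (by omega)
    have := natDegree_sub_le_of_le (natDegree_sub_le_of_le h1 h2) h3
    rw [max_self, max_self] at this
    exact this.trans_lt (by omega)
  have hDq : ∀ j, (X - C (q j)) ^ 2 ∣ D := by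
    intro j
    have h1 : (X - C (q j)) ^ 2 ∣ H - T j := by
      have := hW0 j
      refine sq_X_sub_C_dvd ?_ ?_
      · simp only [hT, hy, eval_sub, eval_add, eval_mul, eval_C, eval_X]
        field_simp
        ring
      · simp only [hT, hy, hs, eval_sub, eval_add, eval_mul, eval_C, eval_X, derivative_sub,
          derivative_add, derivative_mul, derivative_C, derivative_X, hWd, eval_zero, eval_one]
        field_simp
        ring
    have h2 : (X - C (q j)) ^ 2 ∣ ∑ i ∈ univ.erase j, T i := by
      refine Finset.dvd_sum fun i hi => ?_
      have : (X - C (q j)) ^ 2 ∣ W i := Dvd.dvd.mul_right (pow_dvd_pow_of_dvd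
        (Finset.dvd_prod_of_mem (fun β => X - C (q β))
          (Finset.mem_erase.mpr ⟨(Finset.ne_of_mem_erase hi).symm, mem_univ j⟩)) 2) _
      exact dvd_add (this.mul_left _) ((this.mul_left _).mul_left _)
    have h3 : (X - C (q j)) ^ 2 ∣ ∑ n, C (r n) * V n := by
      refine Finset.dvd_sum fun n _ => Dvd.dvd.mul_left (Dvd.dvd.mul_right (pow_dvd_pow_of_dvd
        (Finset.dvd_prod_of_mem (fun β => X - C (q β)) (mem_univ j)) 2) _) _
    have : D = H - T j - ∑ i ∈ univ.erase j, T i - ∑ n, C (r n) * V n := by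
      rw [hD, ← Finset.add_sum_erase univ T (mem_univ j)]
      ring
    rw [this]
    exact dvd_sub (dvd_sub h1 h2) h3
  have hDu : ∀ n, X - C (u n) ∣ D := by
    intro n
    rw [dvd_iff_isRoot, IsRoot.def]
    have h1 : ∀ j, (T j).eval (u n) = 0 := fun j => by
      have hF0 : F.eval (u n) = 0 := by
        rw [hF, eval_prod_X_sub_C]
        exact Finset.prod_eq_zero (mem_univ n) (sub_self (u n))
      simp [hT, hW, hF0]
    have h2 : ∑ m, (C (r m) * V m).eval (u n) = r n * (V n).eval (u n) := by
      rw [Finset.sum_eq_single n]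
      · simp
      · intro m _ hm
        simp only [hV, eval_mul, eval_prod_X_sub_C]
        rw [Finset.prod_eq_zero (Finset.mem_erase.mpr ⟨hm.symm, mem_univ n⟩) (sub_self (u n))]
        simp
      · simp
    have := hV0 n
    simp only [hD, eval_sub, eval_finsetSum, h1]
    rw [h2]
    simp only [hr]
    field_simp
    simp
  have hcop : ∀ {a b : ℂ}, a ≠ b → IsCoprime (X - C a) (X - C b) := fun h =>
    isCoprime_X_sub_C_of_isUnit_sub (sub_ne_zero.mpr h).isUnit
  have hdvd : P ^ 2 * F ∣ D := by
    refine IsCoprime.mul_dvd ?_ ?_ ?_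
    · exact (IsCoprime.prod_left fun j _ => IsCoprime.prod_right fun m _ =>
        hcop (hqu j m)).pow_left
    · rw [hP, ← Finset.prod_pow]
      exact Finset.prod_dvd_of_coprime (fun i _ j _ hij => (hcop (hq i j hij)).pow)
        fun j _ => hDq j
    · exact Finset.prod_dvd_of_coprime (fun i _ j _ hij => hcop (hu i j hij)) fun n _ => hDu n
  have hD0 : D = 0 := by
    refine eq_zero_of_dvd_of_natDegree_lt hdvd (hDd.trans_eq ?_)
    rw [(hPm.pow 2).natDegree_mul (monic_prod_X_sub_C _ _), hPm.natDegree_pow, hP,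
      natDegree_prod_X_sub_C_eq_card, natDegree_prod_X_sub_C_eq_card, card_univ, card_univ]
  have hHeq : H = ∑ j, T j + ∑ n, C (r n) * V n := by
    rw [hD] at hD0
    linear_combination hD0
  have hTc : ∀ j, (T j).coeff (2 * Fintype.card ι + Fintype.card κ - 1) = s j := fun j => by
    have hm := (((monic_X_sub_C (q j)).mul (hWm j))).coeff_natDegree
    rw [hXWn] at hm
    have hlt : (W j).natDegree < 2 * Fintype.card ι + Fintype.card κ - 1 := by
      have := hWn j
      omega
    simp only [hT, coeff_add, coeff_C_mul, hm, coeff_eq_zero_of_natDegree_lt hlt]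
    ring
  have hVc : ∀ n, (C (r n) * V n).coeff (2 * Fintype.card ι + Fintype.card κ - 1) = r n :=
    fun n => by
      have hm := (hVm n).coeff_natDegree
      rw [show (V n).natDegree = 2 * Fintype.card ι + Fintype.card κ - 1 by
        have := hVn n
        omega] at hm
      rw [coeff_C_mul, hm, mul_one]
  conv_rhs => rw [hHeq, coeff_add, finsetSum_coeff, finsetSum_coeff]
  rw [Finset.sum_congr rfl fun j _ => hTc j, Finset.sum_congr rfl fun n _ => hVc n]
  simp only [hs, hr, hWe, hVe]

end HermiteResidues

section ResidueIdentities

open Polynomial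

variable {ι κ : Type*} [Fintype ι] [DecidableEq ι] [Fintype κ] [DecidableEq κ]

theorem sum_sum_erase_comm (f : ι → ι → ℂ) :
    ∑ j, ∑ i ∈ univ.erase j, f j i = ∑ j, ∑ i ∈ univ.erase j, f i j :=
  Finset.sum_comm' fun x y => by simp [eq_comm]

theorem sum_sum_erase_eq_zero (f : ι → ι → ℂ) (hf : ∀ i j, f i j = -f j i) :
    ∑ j, ∑ i ∈ univ.erase j, f j i = 0 := by
  have h' : ∑ j, ∑ i ∈ univ.erase j, f i j = -∑ j, ∑ i ∈ univ.erase j, f j i := by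
    simp only [← Finset.sum_neg_distrib, ← hf]
  linear_combination (1 / 2 : ℂ) * sum_sum_erase_comm f + (1 / 2 : ℂ) * h'

theorem sq_sum_eq_sum_sq_add (f : ι → ℂ) :
    (∑ j, f j) ^ 2 = ∑ j, f j ^ 2 + ∑ j, ∑ i ∈ univ.erase j, f j * f i := by
  rw [sq, Finset.sum_mul_sum, ← Finset.sum_add_distrib]
  refine Finset.sum_congr rfl fun j _ => ?_
  rw [← Finset.add_sum_erase univ _ (mem_univ j), sq]

theorem eval_derivative_prod_erase (q : ι → ℂ) {i j : ι} (hij : q j - q i ≠ 0) :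
    (derivative (∏ β ∈ univ.erase i, (X - C (q β)))).eval (q j) =
      (∏ β ∈ univ.erase j, (q j - q β)) / (q j - q i) := by
  have hne : j ≠ i := fun h => hij (by rw [h, sub_self])
  rw [eval_derivative_prod_X_sub_C_of_mem _ q (Finset.mem_erase.mpr ⟨hne, mem_univ j⟩),
    ← Finset.mul_prod_erase (univ.erase j) _ (Finset.mem_erase.mpr ⟨hne.symm, mem_univ i⟩),
    Finset.erase_right_comm]
  field_simp

theorem eval_prod_erase_of_ne (q : ι → ℂ) {i j : ι} (hij : j ≠ i) :
    (∏ β ∈ univ.erase i, (X - C (q β))).eval (q j) = 0 := by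
  rw [eval_prod_X_sub_C]
  exact Finset.prod_eq_zero (Finset.mem_erase.mpr ⟨hij, mem_univ j⟩) (sub_self (q j))

theorem prod_erase_eq_div (q : ι → ℂ) (x : ℂ) (i : ι) (hx : x - q i ≠ 0) :
    ∏ β ∈ univ.erase i, (x - q β) = (∏ β, (x - q β)) / (x - q i) := by
  rw [← Finset.mul_prod_erase univ _ (mem_univ i)]
  field_simp

/-- The polynomial `∏ (z - q β) * ∑ c i / (z - q i)`. -/
noncomputable def simplePolePoly (q c : ι → ℂ) : ℂ[X] :=
  ∑ i, C (c i) * ∏ β ∈ univ.erase i, (X - C (q β))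

/-- The polynomial `∏ (z - q β)² * ∑ c i * (1 / (z - q i)² + a i / (z - q i))`. -/
noncomputable def doublePolePoly (q c a : ι → ℂ) : ℂ[X] :=
  ∑ i, C (c i) * ((∏ β ∈ univ.erase i, (X - C (q β))) ^ 2 +
    C (a i) * ((∏ β, (X - C (q β))) * ∏ β ∈ univ.erase i, (X - C (q β))))

theorem natDegree_simplePolePoly_le (q c : ι → ℂ) :
    (simplePolePoly q c).natDegree ≤ Fintype.card ι - 1 := by
  refine natDegree_sum_le_of_forall_le _ _ fun i _ => (natDegree_C_mul_le _ _).trans ?_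
  rw [natDegree_prod_X_sub_C_eq_card, Finset.card_erase_of_mem (mem_univ i), card_univ]

theorem natDegree_doublePolePoly_le (q c a : ι → ℂ) :
    (doublePolePoly q c a).natDegree ≤ 2 * Fintype.card ι - 1 := by
  refine natDegree_sum_le_of_forall_le _ _ fun i _ => (natDegree_C_mul_le _ _).trans ?_
  have : 1 ≤ Fintype.card ι := Fintype.card_pos_iff.mpr ⟨i⟩
  refine natDegree_add_le_of_degree_le ?_ ((natDegree_C_mul_le _ _).trans ?_)
  · refine natDegree_pow_le.trans ?_
    rw [natDegree_prod_X_sub_C_eq_card, Finset.card_erase_of_mem (mem_univ i), card_univ]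
    omega
  · refine natDegree_mul_le.trans ?_
    rw [natDegree_prod_X_sub_C_eq_card, natDegree_prod_X_sub_C_eq_card,
      Finset.card_erase_of_mem (mem_univ i), card_univ]
    omega

theorem eval_simplePolePoly (q c : ι → ℂ) {x : ℂ} (hx : ∀ i, x - q i ≠ 0) :
    (simplePolePoly q c).eval x = (∏ β, (x - q β)) * ∑ i, c i / (x - q i) := by
  rw [simplePolePoly, eval_finsetSum, Finset.mul_sum]
  refine Finset.sum_congr rfl fun i _ => ?_
  rw [eval_mul, eval_C, eval_prod_X_sub_C, prod_erase_eq_div q x i (hx i)]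
  ring

theorem eval_doublePolePoly (q c a : ι → ℂ) {x : ℂ} (hx : ∀ i, x - q i ≠ 0) :
    (doublePolePoly q c a).eval x =
      (∏ β, (x - q β)) ^ 2 * ∑ i, c i * (1 / (x - q i) ^ 2 + a i / (x - q i)) := by
  rw [doublePolePoly, eval_finsetSum, Finset.mul_sum]
  refine Finset.sum_congr rfl fun i _ => ?_
  simp only [eval_mul, eval_add, eval_pow, eval_C, eval_prod_X_sub_C]
  rw [prod_erase_eq_div q x i (hx i)]
  field_simp [hx i]

theorem eval_simplePolePoly_node (q c : ι → ℂ) (j : ι) :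
    (simplePolePoly q c).eval (q j) = c j * ∏ β ∈ univ.erase j, (q j - q β) := by
  rw [simplePolePoly, eval_finsetSum, Finset.sum_eq_single j]
  · rw [eval_mul, eval_C, eval_prod_X_sub_C]
  · intro i _ hi
    rw [eval_mul, eval_prod_erase_of_ne q hi.symm, mul_zero]
  · simp

theorem eval_doublePolePoly_node (q c a : ι → ℂ) (j : ι) :
    (doublePolePoly q c a).eval (q j) = c j * (∏ β ∈ univ.erase j, (q j - q β)) ^ 2 := by
  have hP : (∏ β, (X - C (q β))).eval (q j) = 0 := by
    rw [eval_prod_X_sub_C]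
    exact Finset.prod_eq_zero (mem_univ j) (sub_self (q j))
  rw [doublePolePoly, eval_finsetSum, Finset.sum_eq_single j]
  · simp only [eval_mul, eval_add, eval_pow, eval_C, hP]
    rw [eval_prod_X_sub_C]
    ring
  · intro i _ hi
    simp only [eval_mul, eval_add, eval_pow, hP, eval_prod_erase_of_ne q hi.symm]
    ring
  · simp

theorem eval_derivative_simplePolePoly_node (q c : ι → ℂ) (hq : ∀ i j, i ≠ j → q i ≠ q j)
    (j : ι) :
    (derivative (simplePolePoly q c)).eval (q j) = (∏ β ∈ univ.erase j, (q j - q β)) *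
      ∑ i ∈ univ.erase j, (c j + c i) / (q j - q i) := by
  have hqq : ∀ i ∈ univ.erase j, q j - q i ≠ 0 := fun i hi =>
    sub_ne_zero.mpr (hq j i (Finset.ne_of_mem_erase hi).symm)
  rw [simplePolePoly, derivative_sum, eval_finsetSum,
    ← Finset.add_sum_erase univ _ (mem_univ j)]
  simp only [add_div, Finset.sum_add_distrib, mul_add]
  congr 1
  · rw [derivative_C_mul, eval_mul, eval_C, eval_derivative_prod_X_sub_C _ _ _ hqq,
      Finset.mul_sum, Finset.mul_sum, Finset.mul_sum]
    exact Finset.sum_congr rfl fun i _ => by ring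
  · rw [Finset.mul_sum]
    refine Finset.sum_congr rfl fun i hi => ?_
    rw [derivative_C_mul, eval_mul, eval_C, eval_derivative_prod_erase q (hqq i hi)]
    ring

theorem eval_derivative_doublePolePoly_node (q c a : ι → ℂ)
    (hq : ∀ i j, i ≠ j → q i ≠ q j) (j : ι) :
    (derivative (doublePolePoly q c a)).eval (q j) =
      c j * (∏ β ∈ univ.erase j, (q j - q β)) ^ 2 *
        (2 * ∑ i ∈ univ.erase j, 1 / (q j - q i) + a j) := by
  have hqq : ∀ i ∈ univ.erase j, q j - q i ≠ 0 := fun i hi =>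
    sub_ne_zero.mpr (hq j i (Finset.ne_of_mem_erase hi).symm)
  have hP : (∏ β, (X - C (q β))).eval (q j) = 0 := by
    rw [eval_prod_X_sub_C]
    exact Finset.prod_eq_zero (mem_univ j) (sub_self (q j))
  have hP' := eval_derivative_prod_X_sub_C_of_mem univ q (mem_univ j)
  rw [doublePolePoly, derivative_sum, eval_finsetSum, Finset.sum_eq_single j]
  · simp only [derivative_C, zero_mul, zero_add, derivative_add, derivative_sq, derivative_mul,
      eval_mul, eval_add, eval_C, hP, hP', eval_derivative_prod_X_sub_C _ _ _ hqq]
    rw [eval_prod_X_sub_C]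
    ring
  · intro i _ hi
    simp only [derivative_C, zero_mul, zero_add, derivative_add, derivative_sq, derivative_mul,
      eval_mul, eval_add, eval_C, hP, eval_prod_erase_of_ne q hi.symm]
    ring
  · simp

theorem sum_simple_residues_eq_zero (q : ι → ℂ) (u : κ → ℂ) (c a : ι → ℂ)
    (hq : ∀ i j, i ≠ j → q i ≠ q j) (hu : ∀ m n, m ≠ n → u m ≠ u n) (hqu : ∀ j n, q j ≠ u n)
    (hcard : Fintype.card κ = 2 * Fintype.card ι + 1) (hι : 1 ≤ Fintype.card ι) :
    ∑ n, (∏ β, (u n - q β)) ^ 2 * (∑ i, c i * (1 / (u n - q i) ^ 2 + a i / (u n - q i))) /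
      ∏ m ∈ univ.erase n, (u n - u m) = 0 := by
  have hdeg : (doublePolePoly q c a * (∏ β, (X - C (q β))) ^ 2).natDegree <
      2 * Fintype.card ι + Fintype.card κ - 1 := by
    have h1 := natDegree_mul_le (p := doublePolePoly q c a) (q := (∏ β, (X - C (q β))) ^ 2)
    have h2 := natDegree_doublePolePoly_le q c a
    have h3 : ((∏ β, (X - C (q β))) ^ 2).natDegree = 2 * Fintype.card ι := by
      rw [(monic_prod_X_sub_C _ _).natDegree_pow, natDegree_prod_X_sub_C_eq_card, card_univ]
    omega
  have key := sum_residues_eq_coeff q u hq hu hqu _ (hdeg.trans_le (Nat.sub_le _ 1))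
  rw [coeff_eq_zero_of_natDegree_lt hdeg] at key
  refine Eq.trans (Eq.symm ?_) key
  rw [Finset.sum_eq_zero, zero_add]
  · refine Finset.sum_congr rfl fun n _ => ?_
    have hn : ∀ i, u n - q i ≠ 0 := fun i => sub_ne_zero.mpr (hqu i n).symm
    have hP : ∏ β, (u n - q β) ≠ 0 := Finset.prod_ne_zero_iff.mpr fun i _ => hn i
    rw [eval_mul, eval_pow, eval_prod_X_sub_C, eval_doublePolePoly q c a hn]
    rw [mul_comm _ ((∏ β, (u n - q β)) ^ 2), mul_div_mul_left _ _ (pow_ne_zero 2 hP)]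
  · intro j _
    have hP : (∏ β, (X - C (q β))).eval (q j) = 0 := by
      rw [eval_prod_X_sub_C]
      exact Finset.prod_eq_zero (mem_univ j) (sub_self (q j))
    simp only [derivative_mul, derivative_sq, eval_add, eval_mul, eval_pow, hP]
    ring

theorem sum_mul_simple_residues (q : ι → ℂ) (u : κ → ℂ) (c a : ι → ℂ)
    (hq : ∀ i j, i ≠ j → q i ≠ q j) (hu : ∀ m n, m ≠ n → u m ≠ u n) (hqu : ∀ j n, q j ≠ u n)
    (hc : ∀ j, c j ^ 2 * (∏ β ∈ univ.erase j, (q j - q β)) ^ 2 = ∏ m, (q j - u m))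
    (hcard : Fintype.card κ = 2 * Fintype.card ι + 1) (hι : 1 ≤ Fintype.card ι) :
    ∑ n, (∏ β, (u n - q β)) ^ 2 * (∑ i, c i * (1 / (u n - q i) ^ 2 + a i / (u n - q i))) /
      (∏ m ∈ univ.erase n, (u n - u m)) * ∑ i, c i / (u n - q i) = -(Fintype.card ι : ℂ) := by
  have hdeg : (doublePolePoly q c a * simplePolePoly q c * ∏ β, (X - C (q β))).natDegree <
      2 * Fintype.card ι + Fintype.card κ - 1 := by
    have h1 := natDegree_mul_le (p := doublePolePoly q c a * simplePolePoly q c)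
      (q := ∏ β, (X - C (q β)))
    have h2 := natDegree_mul_le (p := doublePolePoly q c a) (q := simplePolePoly q c)
    have h3 := natDegree_doublePolePoly_le q c a
    have h4 := natDegree_simplePolePoly_le q c
    have h5 := natDegree_prod_X_sub_C_eq_card univ q
    rw [card_univ] at h5
    omega
  have key := sum_residues_eq_coeff q u hq hu hqu _ (hdeg.trans_le (Nat.sub_le _ 1))
  rw [coeff_eq_zero_of_natDegree_lt hdeg] at key
  rw [eq_neg_iff_add_eq_zero]
  refine Eq.trans ?_ key
  rw [add_comm]
  congr 1
  · rw [Fintype.card_eq_sum_ones, Nat.cast_sum]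
    refine Finset.sum_congr rfl fun j _ => ?_
    have hP : (∏ β, (X - C (q β))).eval (q j) = 0 := by
      rw [eval_prod_X_sub_C]
      exact Finset.prod_eq_zero (mem_univ j) (sub_self (q j))
    have hF : ∏ m, (q j - u m) ≠ 0 :=
      Finset.prod_ne_zero_iff.mpr fun m _ => sub_ne_zero.mpr (hqu j m)
    rw [← hc] at hF ⊢
    obtain ⟨hc0, hD⟩ := mul_ne_zero_iff.mp hF
    simp only [derivative_mul, eval_add, eval_mul, hP, eval_doublePolePoly_node,
      eval_derivative_prod_X_sub_C_of_mem univ q (mem_univ j), eval_simplePolePoly_node]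
    rw [Nat.cast_one, eq_comm, div_eq_one_iff_eq (mul_ne_zero hD hF)]
    ring
  · refine Finset.sum_congr rfl fun n _ => ?_
    have hn : ∀ i, u n - q i ≠ 0 := fun i => sub_ne_zero.mpr (hqu i n).symm
    have hP : ∏ β, (u n - q β) ≠ 0 := Finset.prod_ne_zero_iff.mpr fun i _ => hn i
    rw [eval_mul, eval_mul, eval_prod_X_sub_C, eval_doublePolePoly q c a hn,
      eval_simplePolePoly q c hn]
    field_simp

theorem sum_mul_sq_simple_residues (q : ι → ℂ) (u : κ → ℂ) (c a : ι → ℂ)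
    (hq : ∀ i j, i ≠ j → q i ≠ q j) (hu : ∀ m n, m ≠ n → u m ≠ u n) (hqu : ∀ j n, q j ≠ u n)
    (hc : ∀ j, c j ^ 2 * (∏ β ∈ univ.erase j, (q j - q β)) ^ 2 = ∏ m, (q j - u m))
    (hcard : Fintype.card κ = 2 * Fintype.card ι + 1) (hι : 1 ≤ Fintype.card ι) :
    ∑ n, (∏ β, (u n - q β)) ^ 2 * (∑ i, c i * (1 / (u n - q i) ^ 2 + a i / (u n - q i))) /
      (∏ m ∈ univ.erase n, (u n - u m)) * (∑ i, c i / (u n - q i)) ^ 2 =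
      -∑ j, c j * a j - ∑ n, ∑ j, c j / (u n - q j) := by
  have hdeg : (doublePolePoly q c a * simplePolePoly q c ^ 2).natDegree <
      2 * Fintype.card ι + Fintype.card κ - 1 := by
    have h1 := natDegree_mul_le (p := doublePolePoly q c a) (q := simplePolePoly q c ^ 2)
    have h2 := natDegree_pow_le (p := simplePolePoly q c) (n := 2)
    have h3 := natDegree_doublePolePoly_le q c a
    have h4 := natDegree_simplePolePoly_le q c
    omega
  have key := sum_residues_eq_coeff q u hq hu hqu _ (hdeg.trans_le (Nat.sub_le _ 1))
  rw [coeff_eq_zero_of_natDegree_lt hdeg] at key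
  have hnode : ∀ j, ((derivative (doublePolePoly q c a * simplePolePoly q c ^ 2)).eval (q j) -
      (doublePolePoly q c a * simplePolePoly q c ^ 2).eval (q j) *
        (2 * ∑ β ∈ univ.erase j, 1 / (q j - q β) + ∑ m, 1 / (q j - u m))) /
        ((∏ β ∈ univ.erase j, (q j - q β)) ^ 2 * ∏ m, (q j - u m)) =
      c j * a j + ∑ n, c j / (u n - q j) +
        2 * ∑ i ∈ univ.erase j, (c j + c i) / (q j - q i) := by
    intro j
    have hF : ∏ m, (q j - u m) ≠ 0 :=
      Finset.prod_ne_zero_iff.mpr fun m _ => sub_ne_zero.mpr (hqu j m)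
    have hS : ∑ n, c j / (u n - q j) = -c j * ∑ m, 1 / (q j - u m) := by
      rw [Finset.mul_sum]
      refine Finset.sum_congr rfl fun m _ => ?_
      rw [← neg_sub (q j) (u m), div_neg]
      ring
    rw [← hc] at hF ⊢
    obtain ⟨hc0, hD⟩ := mul_ne_zero_iff.mp hF
    rw [div_eq_iff (mul_ne_zero hD hF), hS]
    simp only [derivative_mul, derivative_sq, eval_add, eval_mul, eval_pow, eval_C,
      eval_doublePolePoly_node, eval_simplePolePoly_node,
      eval_derivative_doublePolePoly_node q c a hq, eval_derivative_simplePolePoly_node q c hq]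
    ring
  have hanti : ∑ j, ∑ i ∈ univ.erase j, (c j + c i) / (q j - q i) = 0 := by
    refine sum_sum_erase_eq_zero (fun j i => (c j + c i) / (q j - q i)) fun i j => ?_
    rw [← neg_sub (q j) (q i), div_neg, add_comm]
  rw [Finset.sum_congr rfl fun j _ => hnode j, Finset.sum_add_distrib, Finset.sum_add_distrib,
    ← Finset.mul_sum, hanti, Finset.sum_comm] at key
  rw [eq_sub_iff_add_eq, eq_neg_iff_add_eq_zero]
  refine Eq.trans ?_ key
  have hn : ∀ n, (doublePolePoly q c a * simplePolePoly q c ^ 2).eval (u n) /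
      ((∏ β, (u n - q β)) ^ 2 * ∏ m ∈ univ.erase n, (u n - u m)) =
      (∏ β, (u n - q β)) ^ 2 * (∑ i, c i * (1 / (u n - q i) ^ 2 + a i / (u n - q i))) /
      (∏ m ∈ univ.erase n, (u n - u m)) * (∑ i, c i / (u n - q i)) ^ 2 := by
    intro n
    have hn : ∀ i, u n - q i ≠ 0 := fun i => sub_ne_zero.mpr (hqu i n).symm
    have hP : ∏ β, (u n - q β) ≠ 0 := Finset.prod_ne_zero_iff.mpr fun i _ => hn i
    rw [eval_mul, eval_pow, eval_doublePolePoly q c a hn, eval_simplePolePoly q c hn]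
    field_simp
  rw [Finset.sum_congr rfl fun n _ => hn n]
  ring

/-- The residue theorem for `∏_{m ≠ k, n} (z - u m) / ∏ (z - q j)²`. -/
theorem sum_double_residues_eq_one (q : ι → ℂ) (u : κ → ℂ) (c : ι → ℂ)
    (hq : ∀ i j, i ≠ j → q i ≠ q j) (hu : ∀ m n, m ≠ n → u m ≠ u n) (hqu : ∀ j n, q j ≠ u n)
    (hc : ∀ j, c j ^ 2 * (∏ β ∈ univ.erase j, (q j - q β)) ^ 2 = ∏ m, (q j - u m))
    (hcard : Fintype.card κ = 2 * Fintype.card ι + 1) {k n : κ} (hkn : k ≠ n) :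
    ∑ j, c j ^ 2 * (1 / (u n - q j)) * (1 / (u k - q j)) *
      (∑ m, 1 / (q j - u m) - 2 * ∑ i ∈ univ.erase j, 1 / (q j - q i) +
        1 / (u k - q j) + 1 / (u n - q j)) = 1 := by
  have hn : n ∈ univ.erase k := Finset.mem_erase.mpr ⟨hkn.symm, mem_univ n⟩
  set F : ℂ[X] := ∏ m, (X - C (u m)) with hF
  set G : ℂ[X] := ∏ m ∈ (univ.erase k).erase n, (X - C (u m)) with hG
  have hFm : F.Monic := monic_prod_X_sub_C _ _
  have hGm : G.Monic := monic_prod_X_sub_C _ _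
  have hdeg : (F * G).natDegree = 2 * Fintype.card ι + Fintype.card κ - 1 := by
    have h2 : 1 < Fintype.card κ := Fintype.one_lt_card_iff.mpr ⟨k, n, hkn⟩
    rw [hFm.natDegree_mul hGm, natDegree_prod_X_sub_C_eq_card, natDegree_prod_X_sub_C_eq_card,
      Finset.card_erase_of_mem hn, Finset.card_erase_of_mem (mem_univ k), card_univ]
    omega
  have key := sum_residues_eq_coeff q u hq hu hqu (F * G) (by omega)
  rw [← hdeg, (hFm.mul hGm).coeff_natDegree] at key
  refine Eq.trans (Eq.symm ?_) key
  have h0 : ∑ m, (F * G).eval (u m) /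
      ((∏ β, (u m - q β)) ^ 2 * ∏ l ∈ univ.erase m, (u m - u l)) = 0 := by
    refine Finset.sum_eq_zero fun m _ => ?_
    rw [eval_mul, eval_prod_X_sub_C, Finset.prod_eq_zero (mem_univ m) (sub_self (u m)),
      zero_mul, zero_div]
  rw [h0, add_zero]
  refine Finset.sum_congr rfl fun j _ => ?_
  have hju : ∀ m, q j - u m ≠ 0 := fun m => sub_ne_zero.mpr (hqu j m)
  have hFe : F.eval (q j) = (q j - u k) * ((q j - u n) * G.eval (q j)) := by
    rw [hF, hG, eval_prod_X_sub_C, eval_prod_X_sub_C,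
      Finset.mul_prod_erase _ (fun m => q j - u m) hn,
      Finset.mul_prod_erase univ (fun m => q j - u m) (mem_univ k)]
  have hF' : (derivative F).eval (q j) = F.eval (q j) * ∑ m, 1 / (q j - u m) := by
    rw [hF, eval_derivative_prod_X_sub_C _ _ _ fun m _ => hju m, eval_prod_X_sub_C]
  have hG' : (derivative G).eval (q j) = G.eval (q j) *
      (∑ m, 1 / (q j - u m) - 1 / (q j - u k) - 1 / (q j - u n)) := by
    rw [hG, eval_derivative_prod_X_sub_C _ _ _ fun m _ => hju m, eval_prod_X_sub_C,
      ← Finset.add_sum_erase univ _ (mem_univ k), ← Finset.add_sum_erase _ _ hn]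
    ring
  have hFc : F.eval (q j) = c j ^ 2 * (∏ β ∈ univ.erase j, (q j - q β)) ^ 2 := by
    rw [hF, eval_prod_X_sub_C, hc]
  have hF0 : ∏ m, (q j - u m) ≠ 0 := Finset.prod_ne_zero_iff.mpr fun m _ => hju m
  have hcD := hc j
  have hD : (∏ β ∈ univ.erase j, (q j - q β)) ≠ 0 :=
    Finset.prod_ne_zero_iff.mpr fun i hi =>
      sub_ne_zero.mpr (hq j i (Finset.ne_of_mem_erase hi).symm)
  have hFe' : ∏ m, (q j - u m) = F.eval (q j) := by rw [hF, eval_prod_X_sub_C]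
  rw [hFe'] at hF0 ⊢
  rw [← neg_sub (q j) (u n), ← neg_sub (q j) (u k)]
  simp only [derivative_mul, eval_add, eval_mul, hF', hG']
  have hk := hju k
  have hn' := hju n
  have hGe : G.eval (q j) = c j ^ 2 * (∏ β ∈ univ.erase j, (q j - q β)) ^ 2 /
      ((q j - u k) * (q j - u n)) := by
    rw [← hFc, hFe]
    field_simp
  rw [hGe]
  generalize (∑ m, 1 / (q j - u m)) = S
  generalize (∑ i ∈ univ.erase j, 1 / (q j - q i)) = E
  generalize F.eval (q j) = Fq at *
  generalize (∏ β ∈ univ.erase j, (q j - q β)) = Dj at *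
  generalize q j - u k = x at *
  generalize q j - u n = y at *
  field_simp
  ring

/-- The quadratic identity behind the evolution of the diagonal of the residue matrices. -/
theorem quadratic_residue_identity (q : ι → ℂ) (u : κ → ℂ) (c : ι → ℂ)
    (hq : ∀ i j, i ≠ j → q i ≠ q j) (hu : ∀ m n, m ≠ n → u m ≠ u n) (hqu : ∀ j n, q j ≠ u n)
    (hc : ∀ j, c j ^ 2 * (∏ β ∈ univ.erase j, (q j - q β)) ^ 2 = ∏ m, (q j - u m))
    (hcard : Fintype.card κ = 2 * Fintype.card ι + 1) {k n : κ} (hkn : k ≠ n) :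
    ∑ j, (c j / (u n - q j) * (-(1 / 2) * (c j / (u k - q j)) * ∑ m, 1 / (q j - u m) +
        ∑ i ∈ univ.erase j, (c j / (u k - q j) - c i / (u k - q i)) / (q j - q i)) -
      c j * (c j / (u k - q j)) / (u n - q j) ^ 2) + 1 / 2 =
      -(u k - u n) / 2 * (∑ j, c j / ((u n - q j) * (u k - q j))) ^ 2 := by
  have hx : ∀ m j, u m - q j ≠ 0 := fun m j => sub_ne_zero.mpr (hqu j m).symm
  have key := sum_double_residues_eq_one q u c hq hu hqu hc hcard hkn
  have hcross : 2 * ∑ j, ∑ i ∈ univ.erase j,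
      c j / (u n - q j) * (c i / (u k - q i)) / (q j - q i) = (u k - u n) *
      ∑ j, ∑ i ∈ univ.erase j, c j / ((u n - q j) * (u k - q j)) *
        (c i / ((u n - q i) * (u k - q i))) := by
    rw [two_mul]
    nth_rewrite 2 [sum_sum_erase_comm fun j i =>
      c j / (u n - q j) * (c i / (u k - q i)) / (q j - q i)]
    simp only [Finset.mul_sum, ← Finset.sum_add_distrib]
    refine Finset.sum_congr rfl fun j _ => Finset.sum_congr rfl fun i hi => ?_
    have hji : q j - q i ≠ 0 := sub_ne_zero.mpr (hq j i (Finset.ne_of_mem_erase hi).symm)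
    rw [← neg_sub (q j) (q i)]
    have h1 := hx n j
    have h2 := hx n i
    have h3 := hx k j
    have h4 := hx k i
    field_simp
    ring
  have hterm : ∀ j, c j / (u n - q j) * (-(1 / 2) * (c j / (u k - q j)) *
        ∑ m, 1 / (q j - u m) +
        ∑ i ∈ univ.erase j, (c j / (u k - q j) - c i / (u k - q i)) / (q j - q i)) -
      c j * (c j / (u k - q j)) / (u n - q j) ^ 2 =
      -(1 / 2) * (c j ^ 2 * (1 / (u n - q j)) * (1 / (u k - q j)) *
      (∑ m, 1 / (q j - u m) - 2 * ∑ i ∈ univ.erase j, 1 / (q j - q i) +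
        1 / (u k - q j) + 1 / (u n - q j))) -
      ∑ i ∈ univ.erase j, c j / (u n - q j) * (c i / (u k - q i)) / (q j - q i) -
      (u k - u n) / 2 * (c j / ((u n - q j) * (u k - q j))) ^ 2 := by
    intro j
    have hs : ∑ i ∈ univ.erase j, (c j / (u k - q j) - c i / (u k - q i)) / (q j - q i) =
        c j / (u k - q j) * ∑ i ∈ univ.erase j, 1 / (q j - q i) -
        ∑ i ∈ univ.erase j, (c i / (u k - q i)) / (q j - q i) := by
      rw [Finset.mul_sum, ← Finset.sum_sub_distrib]
      exact Finset.sum_congr rfl fun i _ => by ring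
    have hs' : ∑ i ∈ univ.erase j, c j / (u n - q j) * (c i / (u k - q i)) / (q j - q i) =
        c j / (u n - q j) * ∑ i ∈ univ.erase j, (c i / (u k - q i)) / (q j - q i) := by
      rw [Finset.mul_sum]
      exact Finset.sum_congr rfl fun i _ => by ring
    rw [hs, hs']
    have h1 := hx n j
    have h2 := hx k j
    generalize ∑ i ∈ univ.erase j, (c i / (u k - q i)) / (q j - q i) = K
    generalize ∑ i ∈ univ.erase j, 1 / (q j - q i) = E
    generalize ∑ m, 1 / (q j - u m) = S
    field_simp
    ring
  rw [Finset.sum_congr rfl fun j _ => hterm j, Finset.sum_sub_distrib, Finset.sum_sub_distrib,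
    ← Finset.mul_sum, key, ← Finset.mul_sum, sq_sum_eq_sum_sq_add]
  linear_combination -(1 / 2 : ℂ) * hcross

end ResidueIdentities

section Derivatives

theorem hasDerivAt_prod_of_ne_zero {ι : Type*} [DecidableEq ι] (s : Finset ι) (f : ι → ℂ → ℂ)
    (f' : ι → ℂ) (x : ℂ) (hf : ∀ i ∈ s, HasDerivAt (f i) (f' i) x)
    (h0 : ∀ i ∈ s, f i x ≠ 0) :
    HasDerivAt (fun t => ∏ i ∈ s, f i t) ((∏ i ∈ s, f i x) * ∑ i ∈ s, f' i / f i x) x := by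
  refine (HasDerivAt.fun_finsetProd hf).congr_deriv (Eq.symm ?_)
  rw [Finset.mul_sum]
  refine Finset.sum_congr rfl fun i hi => ?_
  rw [← Finset.mul_prod_erase s _ hi, smul_eq_mul]
  have := h0 i hi
  field_simp

variable {ι κ : Type*} [Fintype ι] [DecidableEq ι] [Fintype κ] [DecidableEq κ]

theorem hasDerivAt_inv_sqrt_prod {q w : ℂ → ℂ} {p : κ → ℂ → ℂ} {q' w' t₀ : ℂ} (k : κ)
    (hq : HasDerivAt q q' t₀) (hw : HasDerivAt w w' t₀)
    (hp : ∀ m, HasDerivAt (p m) (if m = k then 1 else 0) t₀)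
    (hqp : ∀ m, q t₀ - p m t₀ ≠ 0)
    (h : ∀ᶠ t in nhds t₀, w t ^ 2 * ∏ m, (q t - p m t) = 1) :
    w' = -(1 / 2) * w t₀ * (q' * ∑ m, 1 / (q t₀ - p m t₀) - 1 / (q t₀ - p k t₀)) := by
  have hprod := hasDerivAt_prod_of_ne_zero univ (fun m t => q t - p m t)
    (fun m => q' - if m = k then 1 else 0) t₀ (fun m _ => hq.sub (hp m)) fun m _ => hqp m
  have hmul := (hw.pow 2).mul hprod
  have hconst : HasDerivAt (fun t => w t ^ 2 * ∏ m, (q t - p m t)) 0 t₀ :=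
    (hasDerivAt_const t₀ (1 : ℂ)).congr_of_eventuallyEq h
  have heq := hmul.unique hconst
  have hsum : ∑ m, (q' - if m = k then 1 else 0) / (q t₀ - p m t₀) =
      q' * ∑ m, 1 / (q t₀ - p m t₀) - 1 / (q t₀ - p k t₀) := by
    simp only [sub_div, Finset.sum_sub_distrib, ite_div, zero_div, Finset.sum_ite_eq',
      mem_univ, if_true, Finset.mul_sum, mul_one_div]
  have h1 : w t₀ ^ 2 * ∏ m, (q t₀ - p m t₀) = 1 := h.self_of_nhds
  have hw0 : w t₀ ≠ 0 := fun h0 => by simp [h0] at h1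
  have hP0 : ∏ m, (q t₀ - p m t₀) ≠ 0 := fun h0 => by simp [h0] at h1
  simp only [hsum, Pi.pow_apply] at heq
  have : w t₀ * (∏ m, (q t₀ - p m t₀)) * 2 * (w' - -(1 / 2) * w t₀ *
      (q' * ∑ m, 1 / (q t₀ - p m t₀) - 1 / (q t₀ - p k t₀))) = 0 := by
    linear_combination heq
  have h2 := (mul_eq_zero.mp this).resolve_left
    (mul_ne_zero (mul_ne_zero hw0 hP0) two_ne_zero)
  exact sub_eq_zero.mp h2

/-- Evolution of `∑ 1 / (w j (z - q j) ∏ (q j - q β))` in the direction of `u k`. -/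
theorem hasDerivAt_poleSum {q w : ι → ℂ → ℂ} {p : κ → ℂ → ℂ} {t₀ A : ℂ} {k n : κ}
    (hkn : k ≠ n)
    (hp : ∀ m, HasDerivAt (p m) (if m = k then 1 else 0) t₀)
    (hw : ∀ j, DifferentiableAt ℂ (w j) t₀)
    (hqq : ∀ i j, i ≠ j → q i t₀ ≠ q j t₀) (hpp : ∀ m n, m ≠ n → p m t₀ ≠ p n t₀)
    (hqp : ∀ j m, q j t₀ ≠ p m t₀)
    (h : ∀ j, ∀ᶠ t in nhds t₀, w j t ^ 2 * ∏ m, (q j t - p m t) = 1)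
    (hcard : Fintype.card κ = 2 * Fintype.card ι + 1)
    (hq : ∀ j, HasDerivAt (q j) (-A * ((1 / (w j t₀ * ∏ i ∈ univ.erase j, (q j t₀ - q i t₀))) /
      (p k t₀ - q j t₀))) t₀) :
    HasDerivAt (fun t => ∑ j, 1 / (w j t * (p n t - q j t) *
        ∏ i ∈ univ.erase j, (q j t - q i t)))
      (((∑ j, 1 / (w j t₀ * (p n t₀ - q j t₀) * ∏ i ∈ univ.erase j, (q j t₀ - q i t₀)) -
        ∑ j, 1 / (w j t₀ * (p k t₀ - q j t₀) * ∏ i ∈ univ.erase j, (q j t₀ - q i t₀))) / 2 -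
        A * (∑ j, 1 / (w j t₀ * (p n t₀ - q j t₀) * ∏ i ∈ univ.erase j, (q j t₀ - q i t₀)) -
        ∑ j, 1 / (w j t₀ * (p k t₀ - q j t₀) *
          ∏ i ∈ univ.erase j, (q j t₀ - q i t₀))) ^ 2 / 2) /
        (p k t₀ - p n t₀) - A / 2) t₀ := by
  set D : ι → ℂ := fun j => ∏ i ∈ univ.erase j, (q j t₀ - q i t₀) with hD
  set c : ι → ℂ := fun j => 1 / (w j t₀ * D j) with hc
  have hD0 : ∀ j, D j ≠ 0 := fun j => Finset.prod_ne_zero_iff.mpr fun i hi =>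
    sub_ne_zero.mpr (hqq j i (Finset.ne_of_mem_erase hi).symm)
  have h1 : ∀ j, w j t₀ ^ 2 * ∏ m, (q j t₀ - p m t₀) = 1 := fun j => (h j).self_of_nhds
  have hw0 : ∀ j, w j t₀ ≠ 0 := fun j h0 => by simpa [h0] using h1 j
  have hx : ∀ m j, p m t₀ - q j t₀ ≠ 0 := fun m j => sub_ne_zero.mpr (hqp j m).symm
  have hkn0 : p k t₀ - p n t₀ ≠ 0 := sub_ne_zero.mpr (hpp k n hkn)
  have hc2 : ∀ j, c j ^ 2 * (∏ i ∈ univ.erase j, (q j t₀ - q i t₀)) ^ 2 =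
      ∏ m, (q j t₀ - p m t₀) := fun j => by
    have := hD0 j
    have := hw0 j
    change (1 / (w j t₀ * D j)) ^ 2 * D j ^ 2 = _
    field_simp
    rw [← h1 j]
  have key := quadratic_residue_identity (fun j => q j t₀) (fun m => p m t₀) c hqq hpp hqp hc2
    hcard hkn
  have hS : ∀ m, ∑ j, 1 / (w j t₀ * (p m t₀ - q j t₀) * D j) = ∑ j, c j / (p m t₀ - q j t₀) :=
    fun m => Finset.sum_congr rfl fun j _ => by
      simp only [hc]
      rw [div_div]
      congr 1
      ring
  have hdiff : ∑ j, c j / (p n t₀ - q j t₀) - ∑ j, c j / (p k t₀ - q j t₀) =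
      (p k t₀ - p n t₀) * ∑ j, c j / ((p n t₀ - q j t₀) * (p k t₀ - q j t₀)) := by
    rw [Finset.mul_sum, ← Finset.sum_sub_distrib]
    refine Finset.sum_congr rfl fun j _ => ?_
    have := hx n j
    have := hx k j
    field_simp
    ring
  have hterm : ∀ j, HasDerivAt (fun t => 1 / (w j t * (p n t - q j t) *
        ∏ i ∈ univ.erase j, (q j t - q i t)))
      ((1 / 2) * (c j / ((p n t₀ - q j t₀) * (p k t₀ - q j t₀))) +
        A * (c j / (p n t₀ - q j t₀) * (-(1 / 2) * (c j / (p k t₀ - q j t₀)) *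
          ∑ m, 1 / (q j t₀ - p m t₀) + ∑ i ∈ univ.erase j,
          (c j / (p k t₀ - q j t₀) - c i / (p k t₀ - q i t₀)) / (q j t₀ - q i t₀)) -
        c j * (c j / (p k t₀ - q j t₀)) / (p n t₀ - q j t₀) ^ 2)) t₀ := by
    intro j
    have hwd := (hw j).hasDerivAt
    have hw' := hasDerivAt_inv_sqrt_prod k (hq j) hwd hp
      (fun m => sub_ne_zero.mpr (hqp j m)) (h j)
    have hDd := hasDerivAt_prod_of_ne_zero (univ.erase j) (fun i t => q j t - q i t) _ t₀
      (fun i _ => (hq j).sub (hq i)) fun i hi =>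
        sub_ne_zero.mpr (hqq j i (Finset.ne_of_mem_erase hi).symm)
    have hpn := hp n
    rw [if_neg hkn.symm] at hpn
    have hden0 : w j t₀ * (p n t₀ - q j t₀) * D j ≠ 0 :=
      mul_ne_zero (mul_ne_zero (hw0 j) (hx n j)) (hD0 j)
    have hsum : ∑ i ∈ univ.erase j, (-A * (c j / (p k t₀ - q j t₀)) -
        -A * (c i / (p k t₀ - q i t₀))) / (q j t₀ - q i t₀) =
        -A * ∑ i ∈ univ.erase j,
          (c j / (p k t₀ - q j t₀) - c i / (p k t₀ - q i t₀)) / (q j t₀ - q i t₀) := by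
      rw [Finset.mul_sum]
      exact Finset.sum_congr rfl fun i _ => by ring
    have hall := (((hwd.mul (hpn.sub (hq j))).mul hDd).inv hden0)
    simp only [one_div (_ * _ * _)]
    refine hall.congr_deriv ?_
    change -((_ + _) * D j + _ * (D j * ∑ i ∈ univ.erase j, (-A * (c j / (p k t₀ - q j t₀)) -
      -A * (c i / (p k t₀ - q i t₀))) / (q j t₀ - q i t₀))) /
      (w j t₀ * (p n t₀ - q j t₀) * D j) ^ 2 = _
    change _ = -(1 / 2) * w j t₀ * (-A * (c j / (p k t₀ - q j t₀)) *
      ∑ m, 1 / (q j t₀ - p m t₀) - 1 / (q j t₀ - p k t₀)) at hw'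
    rw [hsum, hw']
    change -((_ + w j t₀ * (0 - -A * (c j / (p k t₀ - q j t₀)))) * D j +
      w j t₀ * (p n t₀ - q j t₀) * _) / _ = _
    rw [← neg_sub (p k t₀) (q j t₀)]
    have e1 : w j t₀ * D j = 1 / c j := by simp [hc]
    have hcj : c j ≠ 0 := one_div_ne_zero (mul_ne_zero (hw0 j) (hD0 j))
    have hDj : D j = 1 / (c j * w j t₀) := by
      have := one_div_mul_cancel hcj
      rw [← e1] at this
      rw [eq_div_iff (mul_ne_zero hcj (hw0 j))]
      linear_combination this
    generalize ∑ i ∈ univ.erase j,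
      (c j / (p k t₀ - q j t₀) - c i / (p k t₀ - q i t₀)) / (q j t₀ - q i t₀) = E
    generalize ∑ m, 1 / (q j t₀ - p m t₀) = S
    rw [hDj]
    have g1 := hw0 j
    have g2 := hx n j
    have g3 := hx k j
    simp only [Pi.sub_apply]
    generalize c j = cj at *
    generalize w j t₀ = wj at *
    field_simp
    ring
  refine (HasDerivAt.fun_sum fun j _ => hterm j).congr_deriv ?_
  rw [hS, hS, hdiff, Finset.sum_add_distrib, ← Finset.mul_sum, ← Finset.mul_sum]
  have e2 : (∑ j, (c j / (p n t₀ - q j t₀) * (-(1 / 2) * (c j / (p k t₀ - q j t₀)) *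
          ∑ m, 1 / (q j t₀ - p m t₀) + ∑ i ∈ univ.erase j,
          (c j / (p k t₀ - q j t₀) - c i / (p k t₀ - q i t₀)) / (q j t₀ - q i t₀)) -
        c j * (c j / (p k t₀ - q j t₀)) / (p n t₀ - q j t₀) ^ 2)) =
        -(p k t₀ - p n t₀) / 2 *
          (∑ j, c j / ((p n t₀ - q j t₀) * (p k t₀ - q j t₀))) ^ 2 - 1 / 2 := by
    linear_combination key
  rw [e2]
  field_simp
  ring

/-- The Schlesinger equation for `resMat (A * B) A`, from the evolution of `A` and `B`. -/
theorem hasDerivAt_resMat {A B : ℂ → ℂ} {t₀ Ak Bk d : ℂ} (hA0 : A t₀ ≠ 0) (hAk : Ak ≠ 0)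
    (hd : d ≠ 0)
    (hA : HasDerivAt A (((Ak - A t₀) / 2 + A t₀ * Ak * (B t₀ - Bk)) / d) t₀)
    (hB : HasDerivAt B (((B t₀ - Bk) / 2 - Ak * (B t₀ - Bk) ^ 2 / 2) / d) t₀) (i j : Fin 2) :
    HasDerivAt (fun t => resMat (A t * B t) (A t) i j)
      ((d⁻¹ • (resMat (Ak * Bk) Ak * resMat (A t₀ * B t₀) (A t₀) -
        resMat (A t₀ * B t₀) (A t₀) * resMat (Ak * Bk) Ak)) i j) t₀ := by
  have hβ := hA.fun_mul hB
  fin_cases i <;> fin_cases j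
  · refine ((hβ.div_const 2).const_sub (-(1 : ℂ) / 4)).congr_deriv ?_
    simp [resMat]
    field_simp
    ring
  · refine hA.congr_deriv ?_
    simp [resMat]
    field_simp
    ring
  · refine ((hβ.add (hβ.pow 2)).neg.div (hA.const_mul 4)
      (mul_ne_zero (by norm_num : (4 : ℂ) ≠ 0) hA0)).congr_deriv ?_
    simp [resMat]
    field_simp
    ring
  · refine ((hβ.div_const 2).const_add ((1 : ℂ) / 4)).congr_deriv ?_
    simp [resMat]
    field_simp
    ring

end Derivatives

section Residues

variable {g N : ℕ} {qf wf af : Fin g → (Fin N → ℂ) → ℂ} {ff : Fin N → (Fin N → ℂ) → ℂ}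
  {u : Fin N → ℂ}

theorem A12P_eq (hqu : ∀ (j : Fin g) (n : Fin N), qf j u ≠ u n)
    (hf : ∀ n, (ff n u) ^ 2 * ∏ m ∈ univ.erase n, (u n - u m) = 4) (n : Fin N) :
    A12P qf wf af ff n u = (∏ β, (u n - qf β u)) ^ 2 *
      (∑ i, 1 / (wf i u * ∏ β ∈ univ.erase i, (qf i u - qf β u)) *
        (1 / (u n - qf i u) ^ 2 + af i u / (u n - qf i u))) /
      ∏ m ∈ univ.erase n, (u n - u m) := by
  have hR : Rfun (fun j => qf j u) (fun j => wf j u) (fun j => af j u) (u n) =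
      (∏ β, (u n - qf β u)) * ∑ i, 1 / (wf i u * ∏ β ∈ univ.erase i, (qf i u - qf β u)) *
        (1 / (u n - qf i u) ^ 2 + af i u / (u n - qf i u)) := by
    rw [Rfun, Finset.mul_sum]
    refine Finset.sum_congr rfl fun i _ => ?_
    have hx : u n - qf i u ≠ 0 := sub_ne_zero.mpr (hqu i n).symm
    rw [prod_erase_eq_div (fun β => qf β u) (u n) i hx, div_eq_mul_one_div _ (wf i u * _)]
    generalize 1 / (wf i u * ∏ β ∈ univ.erase i, (qf i u - qf β u)) = c
    field_simp
  have hF0 : ∏ m ∈ univ.erase n, (u n - u m) ≠ 0 := fun h0 => by simpa [h0] using hf n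
  rw [A12P, OmegaP, hR, eq_div_iff hF0]
  linear_combination (1 / 4 : ℂ) * (∏ β, (u n - qf β u)) ^ 2 *
    (∑ i, 1 / (wf i u * ∏ β ∈ univ.erase i, (qf i u - qf β u)) *
        (1 / (u n - qf i u) ^ 2 + af i u / (u n - qf i u))) * hf n

/-- The residue at infinity is constant. -/
theorem sum_AmatP (hg : 1 ≤ g) (hN : N = 2 * g + 1) (hu : ∀ m n : Fin N, m ≠ n → u m ≠ u n)
    (hq : ∀ i j : Fin g, i ≠ j → qf i u ≠ qf j u)
    (hqu : ∀ (j : Fin g) (n : Fin N), qf j u ≠ u n)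
    (hw : ∀ j, (wf j u) ^ 2 * ∏ m, (qf j u - u m) = 1)
    (hf : ∀ n, (ff n u) ^ 2 * ∏ m ∈ univ.erase n, (u n - u m) = 4)
    (hA12 : ∀ n, A12P qf wf af ff n u ≠ 0) :
    ∑ n, AmatP qf wf af ff n u = !![-1 / 4, 0; 0, 1 / 4] := by
  set c : Fin g → ℂ := fun i => 1 / (wf i u * ∏ β ∈ univ.erase i, (qf i u - qf β u)) with hc
  set A : Fin N → ℂ := fun n => A12P qf wf af ff n u with hA
  set S : Fin N → ℂ := fun n => ∑ j, c j / (u n - qf j u) with hS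
  set ω : ℂ := ∑ j, c j * af j u with hω
  have hc2 : ∀ j, c j ^ 2 * (∏ i ∈ univ.erase j, (qf j u - qf i u)) ^ 2 =
      ∏ m, (qf j u - u m) := fun j => by
    have hD0 : ∏ i ∈ univ.erase j, (qf j u - qf i u) ≠ 0 := Finset.prod_ne_zero_iff.mpr
      fun i hi => sub_ne_zero.mpr (hq j i (Finset.ne_of_mem_erase hi).symm)
    have hw0 : wf j u ≠ 0 := fun h0 => by simpa [h0] using hw j
    simp only [hc]
    field_simp
    rw [← hw j]
  have hcard : Fintype.card (Fin N) = 2 * Fintype.card (Fin g) + 1 := by simpa using hN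
  have hg' : 1 ≤ Fintype.card (Fin g) := by simpa using hg
  have hAeq : ∀ n, A n = (∏ β, (u n - qf β u)) ^ 2 *
      (∑ i, c i * (1 / (u n - qf i u) ^ 2 + af i u / (u n - qf i u))) /
      ∏ m ∈ univ.erase n, (u n - u m) := A12P_eq hqu hf
  have h0 : ∑ n, A n = 0 := by
    simp only [hAeq]
    exact sum_simple_residues_eq_zero (fun j => qf j u) u c (fun j => af j u) hq hu hqu hcard hg'
  have h1 : ∑ n, A n * S n = -g := by
    simp only [hAeq, hS]
    simpa using sum_mul_simple_residues (fun j => qf j u) u c (fun j => af j u) hq hu hqu hc2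
      hcard hg'
  have h2 : ∑ n, A n * S n ^ 2 = -ω - ∑ n, S n := by
    simp only [hAeq, hS]
    exact sum_mul_sq_simple_residues (fun j => qf j u) u c (fun j => af j u) hq hu hqu hc2
      hcard hg'
  have hβ : ∀ n, betaP qf wf af ff n u = A n * (S n + ω) := fun n => by
    have e1 : OmegaInfty (fun j => qf j u) (fun j => wf j u) (fun j => af j u) = -2 * ω := by
      rw [OmegaInfty, hω]
      congr 1
      exact Finset.sum_congr rfl fun j _ => by rw [div_eq_mul_one_div, mul_comm]
    have e2 : ∑ j, 1 / (wf j u * (u n - qf j u) *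
        ∏ β ∈ univ.erase j, (qf j u - qf β u)) = S n :=
      Finset.sum_congr rfl fun j _ => by
        rw [div_div]
        congr 1
        ring
    rw [betaP, e1, e2]
    ring
  have hβsum : ∑ n, betaP qf wf af ff n u = -g := by
    simp only [hβ, mul_add, Finset.sum_add_distrib, ← Finset.sum_mul, h0, h1]
    ring
  have hNc : (N : ℂ) = 2 * g + 1 := by rw [hN]; push_cast; ring
  ext i j
  rw [Matrix.sum_apply]
  fin_cases i <;> fin_cases j
  · change ∑ n, (-1 / 4 - betaP qf wf af ff n u / 2) = (-1 / 4 : ℂ)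
    rw [Finset.sum_sub_distrib, ← Finset.sum_div, ← Finset.sum_div, hβsum]
    simp [hNc]
    ring
  · simpa [AmatP, resMat] using h0
  · have e : ∀ n, AmatP qf wf af ff n u 1 0 = -(1 / 4) * (S n + ω + A n * S n ^ 2 +
        2 * ω * (A n * S n) + ω ^ 2 * A n) := fun n => by
      have hn : A n ≠ 0 := hA12 n
      change -(betaP qf wf af ff n u + betaP qf wf af ff n u ^ 2) / (4 * A n) = _
      rw [hβ]
      field_simp
      ring
    simp only [Fin.mk_one, Fin.zero_eta, e, ← Finset.mul_sum, Finset.sum_add_distrib, h0, h1, h2]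
    simp [hNc]
    ring
  · change ∑ n, (1 / 4 + betaP qf wf af ff n u / 2) = (1 / 4 : ℂ)
    rw [Finset.sum_add_distrib, ← Finset.sum_div, ← Finset.sum_div, hβsum]
    simp [hNc]
    ring

end Residues

/-- The paper's solution of the rank-two Schlesinger system associated to the family of
hyperelliptic curves `v² = ∏_{m=1}^{2g+1}(u − u_m)`. -/
theorem hyperelliptic_schlesinger {g N : ℕ} (hg : 1 ≤ g) (hN : N = 2 * g + 1)
    (U : Set (Fin N → ℂ)) (hU : IsOpen U)
    (qf wf af : Fin g → (Fin N → ℂ) → ℂ) (ff : Fin N → (Fin N → ℂ) → ℂ)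
    (hdiff : ∀ u ∈ U, ∀ k : Fin N,
      (∀ j, DifferentiableAt ℂ (fun t => qf j (Function.update u k t)) (u k)) ∧
      (∀ j, DifferentiableAt ℂ (fun t => wf j (Function.update u k t)) (u k)) ∧
      (∀ j, DifferentiableAt ℂ (fun t => af j (Function.update u k t)) (u k)) ∧
      (∀ n, DifferentiableAt ℂ (fun t => ff n (Function.update u k t)) (u k)))
    (hu : ∀ u ∈ U, ∀ m n : Fin N, m ≠ n → u m ≠ u n)
    (hq : ∀ u ∈ U, ∀ i j : Fin g, i ≠ j → qf i u ≠ qf j u)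
    (hqu : ∀ u ∈ U, ∀ (j : Fin g) (n : Fin N), qf j u ≠ u n)
    (hw : ∀ u ∈ U, ∀ j, (wf j u) ^ 2 * ∏ m, (qf j u - u m) = 1)
    (hf : ∀ u ∈ U, ∀ n, (ff n u) ^ 2 * ∏ m ∈ univ.erase n, (u n - u m) = 4)
    (hA12 : ∀ u ∈ U, ∀ n, A12P qf wf af ff n u ≠ 0)
    (hdq : ∀ u ∈ U, ∀ (j : Fin g) (k : Fin N),
      HasDerivAt (fun t => qf j (Function.update u k t))
        (-(1 / 4) * OmegaP qf wf af ff k u * ff k u *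
          (∏ α ∈ univ.erase j, (u k - qf α u)) /
          (wf j u * ∏ α ∈ univ.erase j, (qf j u - qf α u))) (u k))
    (hdO : ∀ u ∈ U, ∀ k n : Fin N, k ≠ n →
      HasDerivAt (fun t => OmegaP qf wf af ff n (Function.update u k t))
        ((1 / 2) * (OmegaP qf wf af ff k u / (u k - u n)) * (ff k u / ff n u) *
          (∏ α, (u k - qf α u)) / (∏ α, (u n - qf α u))) (u k))
    (hdOinf : ∀ u ∈ U, ∀ k : Fin N,
      HasDerivAt (fun t => OmegaInfty (fun j => qf j (Function.update u k t))
          (fun j => wf j (Function.update u k t)) (fun j => af j (Function.update u k t)))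
        (-(1 / 4) * OmegaP qf wf af ff k u * ff k u * ∏ α, (u k - qf α u)) (u k))
    (hdf : ∀ u ∈ U, ∀ k n : Fin N, k ≠ n →
      HasDerivAt (fun t => ff n (Function.update u k t))
        ((1 / 2) * ff n u / (u n - u k)) (u k)) :
    ∀ u ∈ U,
      (∀ k n : Fin N, k ≠ n → ∀ i j : Fin 2,
        HasDerivAt (fun t => AmatP qf wf af ff n (Function.update u k t) i j)
          (((u k - u n)⁻¹ • (AmatP qf wf af ff k u * AmatP qf wf af ff n u
            - AmatP qf wf af ff n u * AmatP qf wf af ff k u)) i j) (u k)) ∧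
      (∀ k : Fin N, ∀ i j : Fin 2,
        HasDerivAt (fun t => AmatP qf wf af ff k (Function.update u k t) i j)
          ((-(∑ n ∈ univ.erase k, (u k - u n)⁻¹ •
            (AmatP qf wf af ff k u * AmatP qf wf af ff n u
              - AmatP qf wf af ff n u * AmatP qf wf af ff k u))) i j) (u k)) := by
  intro u huU
  have hup : ∀ k, ∀ᶠ t in nhds (u k), Function.update u k t ∈ U := fun k => by
    have hcont : ContinuousAt (fun t : ℂ => Function.update u k t) (u k) :=
      (continuous_const.update k continuous_id).continuousAt
    exact hcont.eventually_mem (hU.mem_nhds (by rwa [Function.update_eq_self]))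
  have hoff : ∀ k n : Fin N, k ≠ n → ∀ i j : Fin 2,
      HasDerivAt (fun t => AmatP qf wf af ff n (Function.update u k t) i j)
        (((u k - u n)⁻¹ • (AmatP qf wf af ff k u * AmatP qf wf af ff n u
          - AmatP qf wf af ff n u * AmatP qf wf af ff k u)) i j) (u k) := by
    intro k n hkn i j
    have hx : ∀ m j, u m - qf j u ≠ 0 := fun m j => sub_ne_zero.mpr (hqu u huU j m).symm
    have hkn0 : u k - u n ≠ 0 := sub_ne_zero.mpr (hu u huU k n hkn)
    set S : Fin N → ℂ := fun m => ∑ j, 1 / (wf j u * (u m - qf j u) *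
      ∏ β ∈ univ.erase j, (qf j u - qf β u)) with hS
    have hp : ∀ m, HasDerivAt (fun t => Function.update u k t m) (if m = k then 1 else 0)
        (u k) := fun m => by
      simpa [Pi.single_apply] using hasDerivAt_pi.mp (hasDerivAt_update u k (u k)) m
    have hq' : ∀ j, HasDerivAt (fun t => qf j (Function.update u k t))
        (-A12P qf wf af ff k u * ((1 / (wf j u * ∏ β ∈ univ.erase j, (qf j u - qf β u))) /
          (u k - qf j u))) (u k) := fun j => by
      refine (hdq u huU j k).congr_deriv ?_
      rw [prod_erase_eq_div (fun α => qf α u) (u k) j (hx k j), A12P]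
      ring
    have hSd : HasDerivAt (fun t => ∑ j, 1 / (wf j (Function.update u k t) *
        (Function.update u k t n - qf j (Function.update u k t)) *
        ∏ β ∈ univ.erase j, (qf j (Function.update u k t) - qf β (Function.update u k t))))
        (((S n - S k) / 2 - A12P qf wf af ff k u * (S n - S k) ^ 2 / 2) / (u k - u n) -
          A12P qf wf af ff k u / 2) (u k) := by
      have := hasDerivAt_poleSum (q := fun j t => qf j (Function.update u k t))
        (w := fun j t => wf j (Function.update u k t))
        (p := fun m t => Function.update u k t m) (t₀ := u k) (A := A12P qf wf af ff k u)
        hkn hp (hdiff u huU k).2.1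
        (by simpa only [Function.update_eq_self] using hq u huU)
        (by simpa only [Function.update_eq_self] using hu u huU)
        (by simpa only [Function.update_eq_self] using hqu u huU)
        (fun j => (hup k).mono fun t ht => hw _ ht j) (by simpa using hN)
        (by simpa only [Function.update_eq_self] using hq')
      simpa only [Function.update_eq_self] using this
    have hB : HasDerivAt (fun t => (∑ j, 1 / (wf j (Function.update u k t) *
        (Function.update u k t n - qf j (Function.update u k t)) *
        ∏ β ∈ univ.erase j, (qf j (Function.update u k t) - qf β (Function.update u k t)))) -
        OmegaInfty (fun j => qf j (Function.update u k t))
          (fun j => wf j (Function.update u k t)) (fun j => af j (Function.update u k t)) / 2)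
        (((S n - S k) / 2 - A12P qf wf af ff k u * (S n - S k) ^ 2 / 2) / (u k - u n))
        (u k) := by
      refine (hSd.sub ((hdOinf u huU k).div_const 2)).congr_deriv ?_
      rw [A12P]
      ring
    have hSdiff : ∑ j, (1 / (wf j u * ∏ β ∈ univ.erase j, (qf j u - qf β u))) /
        (u k - qf j u) / (u n - qf j u) = (S n - S k) / (u k - u n) := by
      rw [eq_div_iff hkn0, hS, ← Finset.sum_sub_distrib, Finset.sum_mul]
      refine Finset.sum_congr rfl fun j _ => ?_
      have h1 := hx k j
      have h2 := hx n j
      have hfac : ∀ x, 1 / (wf j u * x * ∏ β ∈ univ.erase j, (qf j u - qf β u)) =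
          1 / (wf j u * ∏ β ∈ univ.erase j, (qf j u - qf β u)) / x := fun x => by
        rw [mul_right_comm, div_div]
      rw [hfac, hfac]
      generalize 1 / (wf j u * ∏ β ∈ univ.erase j, (qf j u - qf β u)) = c
      field_simp
      ring
    have hA : HasDerivAt (fun t => A12P qf wf af ff n (Function.update u k t))
        (((A12P qf wf af ff k u - A12P qf wf af ff n u) / 2 +
          A12P qf wf af ff n u * A12P qf wf af ff k u * (S n - S k)) / (u k - u n)) (u k) := by
      have hpn := hp n
      rw [if_neg hkn.symm] at hpn
      have hprod := hasDerivAt_prod_of_ne_zero univ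
        (fun β t => Function.update u k t n - qf β (Function.update u k t)) _ (u k)
        (fun β _ => hpn.sub (hq' β)) (fun β _ => by
          simpa only [Function.update_eq_self] using hx n β)
      have hsum : ∑ j, (0 - -A12P qf wf af ff k u * ((1 / (wf j u *
          ∏ β ∈ univ.erase j, (qf j u - qf β u))) / (u k - qf j u))) / (u n - qf j u) =
          A12P qf wf af ff k u * ((S n - S k) / (u k - u n)) := by
        rw [← hSdiff, Finset.mul_sum]
        exact Finset.sum_congr rfl fun j _ => by ring
      have hf0 : ff n u ≠ 0 := fun h0 => by simpa [h0] using hf u huU n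
      have hP0 : ∏ β, (u n - qf β u) ≠ 0 := Finset.prod_ne_zero_iff.mpr fun β _ => hx n β
      have hall := (((hdO u huU k n hkn).const_mul (1 / 4)).mul (hdf u huU k n hkn)).mul hprod
      refine hall.congr_deriv ?_
      simp only [Function.update_eq_self, hsum, Pi.mul_apply]
      rw [← neg_sub (u k) (u n)]
      simp only [A12P]
      field_simp
      ring
    have := hasDerivAt_resMat (A := fun t => A12P qf wf af ff n (Function.update u k t))
      (B := fun t => (∑ j, 1 / (wf j (Function.update u k t) *
        (Function.update u k t n - qf j (Function.update u k t)) *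
        ∏ β ∈ univ.erase j, (qf j (Function.update u k t) - qf β (Function.update u k t)))) -
        OmegaInfty (fun j => qf j (Function.update u k t))
          (fun j => wf j (Function.update u k t)) (fun j => af j (Function.update u k t)) / 2)
      (t₀ := u k) (Ak := A12P qf wf af ff k u)
      (Bk := S k - OmegaInfty (fun j => qf j u) (fun j => wf j u) (fun j => af j u) / 2)
      (by simpa only [Function.update_eq_self] using hA12 u huU n) (hA12 u huU k) hkn0
      (by simpa only [Function.update_eq_self, sub_sub_sub_cancel_right] using hA)
      (by simpa only [Function.update_eq_self, sub_sub_sub_cancel_right] using hB) i j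
    simp only [Function.update_eq_self] at this
    exact this
  refine ⟨hoff, fun k i j => ?_⟩
  have hsum : ∀ p ∈ U, AmatP qf wf af ff k p i j =
      (!![-1 / 4, 0; 0, 1 / 4] : Matrix (Fin 2) (Fin 2) ℂ) i j -
        ∑ n ∈ univ.erase k, AmatP qf wf af ff n p i j := fun p hpU => by
    rw [← sum_AmatP hg hN (hu p hpU) (hq p hpU) (hqu p hpU) (hw p hpU) (hf p hpU) (hA12 p hpU),
      Matrix.sum_apply, ← Finset.add_sum_erase univ _ (mem_univ k), add_sub_cancel_right]
  have hder := (HasDerivAt.fun_sum fun n (hn : n ∈ univ.erase k) =>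
    hoff k n (Finset.ne_of_mem_erase hn).symm i j).const_sub
      ((!![-1 / 4, 0; 0, 1 / 4] : Matrix (Fin 2) (Fin 2) ℂ) i j)
  refine (hder.congr_of_eventuallyEq ((hup k).mono fun t ht => hsum _ ht)).congr_deriv ?_
  rw [Matrix.neg_apply, Matrix.sum_apply]
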